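/- Let M be a spacelike surface in ℝ^{3,1} with a canonical normal null direction Z, and suppose a ≠ 0. Then the 1-form β is given by β(X) = ⟨X, (K/a) Z^⊤ + (−K_N/a) W⟩ for every tangent vector X. In particular, if a ≠ 0 and K = K_N = 0 at every point, then Z^⊥ is a parallel normal vector field on M. -/

import Mathlib

noncomputable section

/-- Points of the parameter domain of the surface chart. -/
abbrev Pt : Type := ℝ × ℝ

/-- Vectors of the Minkowski space `ℝ^{3,1}`. -/
abbrev E4 : Type := Fin 4 → ℝ

/-- The Minkowski bilinear form of signature `(+,+,+,-)` on `ℝ⁴`. -/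
def mink (v w : E4) : ℝ := v 0 * w 0 + v 1 * w 1 + v 2 * w 2 - v 3 * w 3

/-- Realization in `ℝ^{3,1}` of a coordinate vector field `X` along the immersion `ψ`. -/
def vecF (ψ : Pt → E4) (X : Pt → Pt) : Pt → E4 := fun p => fderiv ℝ ψ p (X p)

/-- Flat (ambient) derivative of an `ℝ⁴`-valued field along a coordinate vector field. -/
def Dflat (X : Pt → Pt) (V : Pt → E4) : Pt → E4 := fun p => fderiv ℝ V p (X p)

/-- Second fundamental form `B(X,Y) = ∇̄_X Y − ∇_X Y`. -/
def sff (ψ : Pt → E4) (conn : (Pt → Pt) → (Pt → Pt) → Pt → Pt) (X Y : Pt → Pt) : Pt → E4 :=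
  fun p => Dflat X (vecF ψ Y) p - vecF ψ (conn X Y) p

/-- `v` is tangent to the surface at `p`. -/
def isTangentV (ψ : Pt → E4) (p : Pt) (v : E4) : Prop := ∃ w : Pt, fderiv ℝ ψ p w = v

/-- `v` is normal to the surface at `p`. -/
def isNormalV (ψ : Pt → E4) (p : Pt) (v : E4) : Prop := ∀ w : Pt, mink v (fderiv ℝ ψ p w) = 0

/-- Lie bracket of coordinate vector fields on the chart. -/
def lieB (X Y : Pt → Pt) : Pt → Pt := fun p => fderiv ℝ Y p (X p) - fderiv ℝ X p (Y p)

/-- Curvature tensor `R(X,Y)V = ∇_Y∇_X V − ∇_X∇_Y V + ∇_{[X,Y]}V`. -/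
def curvR (conn : (Pt → Pt) → (Pt → Pt) → Pt → Pt) (X Y V : Pt → Pt) : Pt → Pt :=
  fun p => conn Y (conn X V) p - conn X (conn Y V) p + conn (lieB X Y) V p

/-- Normal curvature tensor `R^⊥(X,Y)ν = ∇⊥_Y∇⊥_X ν − ∇⊥_X∇⊥_Y ν + ∇⊥_{[X,Y]}ν`. -/
def curvRperp (nconn : (Pt → Pt) → (Pt → E4) → Pt → E4) (X Y : Pt → Pt) (ν : Pt → E4) :
    Pt → E4 :=
  fun p => nconn Y (nconn X ν) p - nconn X (nconn Y ν) p + nconn (lieB X Y) ν p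

/-- Determinant of four vectors of `ℝ⁴` (the volume form `e₁∧e₂∧e₃∧e₄ ↦ 1`). -/
def det4 (a b c d : E4) : ℝ := Matrix.det (Matrix.of ![a, b, c, d])

/-- A spacelike surface in `ℝ^{3,1}`, given by a chart `ψ : U → ℝ^{3,1}`, endowed with a
canonical normal null direction with respect to the constant unit spacelike vector `Z`,
together with all the associated geometric data: the Levi-Civita connection `conn`,
the normal connection `nconn`, the tangent part `Z^⊤` (coordinates `ZT`), the oriented
orthonormal completion `W` (coordinates `Wc`), the shape operator `shA = A_{Z^⊥}`,
the 1-form `β` with `B(X,Z^⊤) = β(X)Z^⊥`, and the lightlike normal field `W'` with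
`⟨Z^⊥,W'⟩ = 1`.  Each piece of data is characterized by its defining property. -/
structure CNND where
  U : Set Pt
  hUopen : IsOpen U
  ψ : Pt → E4
  hψ : ContDiffOn ℝ (⊤ : ℕ∞) ψ U
  himm : ∀ p ∈ U, ∀ v : Pt, fderiv ℝ ψ p v = 0 → v = 0
  hspacelike : ∀ p ∈ U, ∀ v : Pt, v ≠ 0 → 0 < mink (fderiv ℝ ψ p v) (fderiv ℝ ψ p v)
  /-- Levi-Civita connection of the induced metric, as the tangent part of the flat one. -/
  conn : (Pt → Pt) → (Pt → Pt) → Pt → Pt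
  hconn : ∀ X Y, ∀ p ∈ U, DifferentiableAt ℝ (vecF ψ Y) p → isNormalV ψ p (sff ψ conn X Y p)
  hconnSmooth : ∀ X Y, ContDiffOn ℝ (⊤ : ℕ∞) X U → ContDiffOn ℝ (⊤ : ℕ∞) Y U → ContDiffOn ℝ (⊤ : ℕ∞) (conn X Y) U
  /-- Normal connection: the normal part of the flat derivative of a normal field. -/
  nconn : (Pt → Pt) → (Pt → E4) → Pt → E4
  hnconn : ∀ X ν, ∀ p ∈ U, (∀ q ∈ U, isNormalV ψ q (ν q)) → DifferentiableAt ℝ ν p →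
    isNormalV ψ p (nconn X ν p) ∧ isTangentV ψ p (Dflat X ν p - nconn X ν p)
  hnconnSmooth : ∀ X ν, ContDiffOn ℝ (⊤ : ℕ∞) X U → (∀ q ∈ U, isNormalV ψ q (ν q)) →
    ContDiffOn ℝ (⊤ : ℕ∞) ν U → ContDiffOn ℝ (⊤ : ℕ∞) (nconn X ν) U
  /-- The parallel (constant) vector field `Z`, a unit spacelike vector. -/
  Z : E4
  hZunit : mink Z Z = 1
  /-- Coordinates of the tangent part `Z^⊤` of `Z`; `Z^⊥ = Z − Z^⊤` is normal. -/
  ZT : Pt → Pt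
  hZTsmooth : ContDiffOn ℝ (⊤ : ℕ∞) ZT U
  hZTtangentpart : ∀ p ∈ U, isNormalV ψ p (Z - fderiv ℝ ψ p (ZT p))
  /-- canonical normal null direction: `Z^⊥` is lightlike … -/
  hZperpNull : ∀ p ∈ U, mink (Z - fderiv ℝ ψ p (ZT p)) (Z - fderiv ℝ ψ p (ZT p)) = 0
  /-- … and nowhere zero. -/
  hZperpNe : ∀ p ∈ U, Z - fderiv ℝ ψ p (ZT p) ≠ 0
  /-- Coordinates of the unit tangent field `W` orthogonal to `Z^⊤`, positively oriented. -/
  Wc : Pt → Pt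
  hWsmooth : ContDiffOn ℝ (⊤ : ℕ∞) Wc U
  hWunit : ∀ p ∈ U, mink (fderiv ℝ ψ p (Wc p)) (fderiv ℝ ψ p (Wc p)) = 1
  hWorth : ∀ p ∈ U, mink (fderiv ℝ ψ p (ZT p)) (fderiv ℝ ψ p (Wc p)) = 0
  hWorient : ∀ p ∈ U, 0 < (ZT p).1 * (Wc p).2 - (ZT p).2 * (Wc p).1
  /-- The shape operator `A_{Z^⊥}`: `⟨A_{Z^⊥}X, Y⟩ = ⟨B(X,Y), Z^⊥⟩`. -/
  shA : (Pt → Pt) → Pt → Pt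
  hshA : ∀ X Y, ∀ p ∈ U, DifferentiableAt ℝ (vecF ψ Y) p →
    mink (fderiv ℝ ψ p (shA X p)) (fderiv ℝ ψ p (Y p)) =
      mink (sff ψ conn X Y p) (Z - fderiv ℝ ψ p (ZT p))
  /-- The 1-form `β` with `B(X, Z^⊤) = β(X) Z^⊥`. -/
  beta : Pt → Pt → ℝ
  hbeta : ∀ X, ∀ p ∈ U, sff ψ conn X ZT p = beta p (X p) • (Z - fderiv ℝ ψ p (ZT p))
  /-- The lightlike normal field `W'` with `⟨Z^⊥, W'⟩ = 1`, such that
  `(Z^⊤, W, (Z^⊥+W')/√2, (Z^⊥−W')/√2)` is a positively oriented orthonormal frame. -/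
  Wp : Pt → E4
  hWpNormal : ∀ p ∈ U, isNormalV ψ p (Wp p)
  hWpNull : ∀ p ∈ U, mink (Wp p) (Wp p) = 0
  hWpPair : ∀ p ∈ U, mink (Z - fderiv ℝ ψ p (ZT p)) (Wp p) = 1
  hWpOrient : ∀ p ∈ U, 0 < det4 (fderiv ℝ ψ p (ZT p)) (fderiv ℝ ψ p (Wc p))
    ((Real.sqrt 2)⁻¹ • ((Z - fderiv ℝ ψ p (ZT p)) + Wp p))
    ((Real.sqrt 2)⁻¹ • ((Z - fderiv ℝ ψ p (ZT p)) - Wp p))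

namespace CNND

variable (S : CNND)

/-- The normal part `Z^⊥` of `Z` along the surface. -/
def Zperp : Pt → E4 := fun p => S.Z - fderiv ℝ S.ψ p (S.ZT p)

/-- The second fundamental form of the surface. -/
def B : (Pt → Pt) → (Pt → Pt) → Pt → E4 := sff S.ψ S.conn

/-- The function `a = α(W) = ⟨B(W,W), Z^⊥⟩`. -/
def afun : Pt → ℝ := fun p => mink (S.B S.Wc S.Wc p) (S.Zperp p)

/-- The 1-form `α(X) = ⟨B(X,W), Z^⊥⟩`. -/
def alphaF (X : Pt → Pt) : Pt → ℝ := fun p => mink (S.B X S.Wc p) (S.Zperp p)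

/-- The mean curvature vector `H⃗ = (1/2)(B(Z^⊤,Z^⊤) + B(W,W))`. -/
def Hvec : Pt → E4 := fun p => (1 / 2 : ℝ) • (S.B S.ZT S.ZT p + S.B S.Wc S.Wc p)

/-- The Gauss curvature `K = ⟨R(Z^⊤,W)Z^⊤, W⟩`. -/
def Kfun : Pt → ℝ := fun p =>
  mink (fderiv ℝ S.ψ p (curvR S.conn S.ZT S.Wc S.ZT p)) (fderiv ℝ S.ψ p (S.Wc p))

/-- The normal curvature `K_N = ⟨R^⊥(Z^⊤,W)Z^⊥, W'⟩`. -/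
def KNfun : Pt → ℝ := fun p => mink (curvRperp S.nconn S.ZT S.Wc S.Zperp p) (S.Wp p)

end CNND

/-- The wedge `v ∧ w` of two vectors of `ℝ⁴`, as an antisymmetric matrix (bivector). -/
def wedge2 (v w : E4) : Fin 4 → Fin 4 → ℝ := fun i j => v i * w j - v j * w i

/-- The Gauss map `G = Z^⊤ ∧ W : M → Λ²ℝ^{3,1}`. -/
def CNND.Gmap (S : CNND) : Pt → Fin 4 → Fin 4 → ℝ :=
  fun p => wedge2 (fderiv ℝ S.ψ p (S.ZT p)) (fderiv ℝ S.ψ p (S.Wc p))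

/-- The signs of the Minkowski metric. -/
def epsM : Fin 4 → ℝ := fun i => if i = 3 then -1 else 1

/-- The induced (signature `(3,3)`) inner product on bivectors of `ℝ^{3,1}`:
`⟨v∧w, v'∧w'⟩ = ⟨v,v'⟩⟨w,w'⟩ − ⟨v,w'⟩⟨w,v'⟩`. -/
def binner (η η' : Fin 4 → Fin 4 → ℝ) : ℝ :=
  (1 / 2) * ∑ i : Fin 4, ∑ j : Fin 4, epsM i * epsM j * η i j * η' i j

/-- The wedge product `Λ²ℝ^{3,1} × Λ²ℝ^{3,1} → Λ⁴ℝ^{3,1} ≅ ℝ`, normalized so that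
`(v∧w)∧(v'∧w') = det(v,w,v',w')`. -/
def bwedge (η η' : Fin 4 → Fin 4 → ℝ) : ℝ :=
  (1 / 4) * ∑ σ : Equiv.Perm (Fin 4),
    ((Equiv.Perm.sign σ : ℤ) : ℝ) * η (σ 0) (σ 1) * η' (σ 2) (σ 3)

/-- The `ℂ`-bilinear form `H(η,η') = ⟨η,η'⟩ + i η∧η'` on bivectors, where `i = −⋆`. -/
def HformC (η η' : Fin 4 → Fin 4 → ℝ) : ℂ :=
  (binner η η' : ℝ) + (bwedge η η' : ℝ) * Complex.I

/-- The quadratic form `δ(u) = dG(u) ∧ dG(u)` whose zero directions are the asymptotic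
directions. -/
def CNND.deltaQ (S : CNND) (p : Pt) (u : Pt) : ℝ :=
  bwedge (fderiv ℝ S.Gmap p u) (fderiv ℝ S.Gmap p u)

theorem mink_comm (v w : E4) : mink v w = mink w v := by
  simp only [mink]; ring

theorem mink_add_left (u v w : E4) : mink (u + v) w = mink u w + mink v w := by
  simp only [mink, Pi.add_apply]; ring

theorem mink_add_right (u v w : E4) : mink w (u + v) = mink w u + mink w v := by
  simp only [mink, Pi.add_apply]; ring

theorem mink_sub_left (u v w : E4) : mink (u - v) w = mink u w - mink v w := by
  simp only [mink, Pi.sub_apply]; ring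

theorem mink_sub_right (u v w : E4) : mink w (u - v) = mink w u - mink w v := by
  simp only [mink, Pi.sub_apply]; ring

theorem mink_neg_left (v w : E4) : mink (-v) w = -mink v w := by
  simp only [mink, Pi.neg_apply]; ring

theorem mink_smul_left (c : ℝ) (v w : E4) : mink (c • v) w = c * mink v w := by
  simp only [mink, Pi.smul_apply, smul_eq_mul]; ring

theorem mink_smul_right (c : ℝ) (v w : E4) : mink w (c • v) = c * mink w v := by
  simp only [mink, Pi.smul_apply, smul_eq_mul]; ring

theorem mink_zero_right (v : E4) : mink v 0 = 0 := by
  simp [mink]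

/-- Leibniz rule for two fields whose Minkowski product is locally constant. -/
theorem mink_fderiv_add_eq_zero {f g : Pt → E4} {p : Pt} {c : ℝ}
    (hf : DifferentiableAt ℝ f p) (hg : DifferentiableAt ℝ g p)
    (h : ∀ᶠ q in nhds p, mink (f q) (g q) = c) (v : Pt) :
    mink (fderiv ℝ f p v) (g p) + mink (f p) (fderiv ℝ g p v) = 0 := by
  have hf' := hasFDerivAt_pi'.1 hf.hasFDerivAt
  have hg' := hasFDerivAt_pi'.1 hg.hasFDerivAt
  have hd := ((((hf' 0).mul (hg' 0)).add ((hf' 1).mul (hg' 1))).add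
    ((hf' 2).mul (hg' 2))).sub ((hf' 3).mul (hg' 3))
  have hc : HasFDerivAt (fun q => mink (f q) (g q)) (0 : Pt →L[ℝ] ℝ) p :=
    (hasFDerivAt_const c p).congr_of_eventuallyEq h
  have := congrArg (fun L : Pt →L[ℝ] ℝ => L v) (hd.unique hc)
  simp at this
  simp only [mink]
  linarith

/-- Derivative of a field of linear maps evaluated along a vector field. -/
theorem fderiv_fderiv_apply {f : Pt → E4} {X : Pt → Pt} {p : Pt}
    (hf : DifferentiableAt ℝ (fderiv ℝ f) p) (hX : DifferentiableAt ℝ X p) (v : Pt) :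
    fderiv ℝ (fun q => fderiv ℝ f q (X q)) p v =
      fderiv ℝ (fderiv ℝ f) p v (X p) + fderiv ℝ f p (fderiv ℝ X p v) := by
  rw [(hf.hasFDerivAt.clm_apply hX.hasFDerivAt).fderiv]
  simp [add_comm]

theorem fderiv_fderiv_symm {f : Pt → E4} {U : Set Pt} (hU : IsOpen U)
    (hf : ContDiffOn ℝ (⊤ : ℕ∞) f U) {p : Pt} (hp : p ∈ U) (u v : Pt) :
    fderiv ℝ (fderiv ℝ f) p u v = fderiv ℝ (fderiv ℝ f) p v u :=
  ((hf.contDiffAt (hU.mem_nhds hp)).isSymmSndFDerivAt (by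
    rw [minSmoothness_of_isRCLikeNormedField]
    exact WithTop.coe_le_coe.2 le_top)).eq u v

theorem ContDiffOn.fderiv_apply_field {f : Pt → E4} {X : Pt → Pt} {U : Set Pt} (hU : IsOpen U)
    (hf : ContDiffOn ℝ (⊤ : ℕ∞) f U) (hX : ContDiffOn ℝ (⊤ : ℕ∞) X U) :
    ContDiffOn ℝ (⊤ : ℕ∞) (fun q => fderiv ℝ f q (X q)) U :=
  (hf.fderiv_of_isOpen hU (by simp)).clm_apply hX

theorem ContDiffOn.differentiableAt_of_isOpen {E F : Type*} [NormedAddCommGroup E]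
    [NormedSpace ℝ E] [NormedAddCommGroup F] [NormedSpace ℝ F] {f : E → F} {U : Set E}
    (hf : ContDiffOn ℝ (⊤ : ℕ∞) f U) (hU : IsOpen U) {p : E} (hp : p ∈ U) :
    DifferentiableAt ℝ f p :=
  (hf.contDiffAt (hU.mem_nhds hp)).differentiableAt (by simp)

/-- Flatness of the ambient connection. -/
theorem Dflat_Dflat_sub {V : Pt → E4} {X Y : Pt → Pt} {U : Set Pt} (hU : IsOpen U)
    (hV : ContDiffOn ℝ (⊤ : ℕ∞) V U) (hX : ContDiffOn ℝ (⊤ : ℕ∞) X U)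
    (hY : ContDiffOn ℝ (⊤ : ℕ∞) Y U) {p : Pt} (hp : p ∈ U) :
    Dflat Y (Dflat X V) p - Dflat X (Dflat Y V) p + Dflat (lieB X Y) V p = 0 := by
  have hV' : DifferentiableAt ℝ (fderiv ℝ V) p :=
    (hV.fderiv_of_isOpen hU (m := (⊤ : ℕ∞)) (by simp)).differentiableAt_of_isOpen hU hp
  have h1 := fderiv_fderiv_apply hV' (hX.differentiableAt_of_isOpen hU hp) (Y p)
  have h2 := fderiv_fderiv_apply hV' (hY.differentiableAt_of_isOpen hU hp) (X p)
  have h3 : Dflat (lieB X Y) V p =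
      fderiv ℝ V p (fderiv ℝ Y p (X p)) - fderiv ℝ V p (fderiv ℝ X p (Y p)) := map_sub _ _ _
  change fderiv ℝ (fun q => fderiv ℝ V q (X q)) p (Y p) -
    fderiv ℝ (fun q => fderiv ℝ V q (Y q)) p (X p) + _ = 0
  rw [h1, h2, h3, fderiv_fderiv_symm hU hV hp (X p) (Y p)]
  abel

namespace CNND

variable (S : CNND)

theorem contDiffOn_vecF {X : Pt → Pt} (hX : ContDiffOn ℝ (⊤ : ℕ∞) X S.U) :
    ContDiffOn ℝ (⊤ : ℕ∞) (vecF S.ψ X) S.U :=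
  ContDiffOn.fderiv_apply_field S.hUopen S.hψ hX

theorem differentiableAt_vecF {X : Pt → Pt} (hX : ContDiffOn ℝ (⊤ : ℕ∞) X S.U) {p : Pt}
    (hp : p ∈ S.U) : DifferentiableAt ℝ (vecF S.ψ X) p :=
  (S.contDiffOn_vecF hX).differentiableAt_of_isOpen S.hUopen hp

theorem fderiv_vecF {X : Pt → Pt} (hX : ContDiffOn ℝ (⊤ : ℕ∞) X S.U) {p : Pt}
    (hp : p ∈ S.U) (v : Pt) :
    fderiv ℝ (vecF S.ψ X) p v =
      fderiv ℝ (fderiv ℝ S.ψ) p v (X p) + fderiv ℝ S.ψ p (fderiv ℝ X p v) :=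
  fderiv_fderiv_apply
    ((S.hψ.fderiv_of_isOpen S.hUopen (m := (⊤ : ℕ∞)) (by simp)).differentiableAt_of_isOpen
      S.hUopen hp)
    (hX.differentiableAt_of_isOpen S.hUopen hp) v

/-- Symmetry of the second fundamental form, tested against a normal vector. -/
theorem mink_fderiv_vecF_symm {X Y : Pt → Pt} (hX : ContDiffOn ℝ (⊤ : ℕ∞) X S.U)
    (hY : ContDiffOn ℝ (⊤ : ℕ∞) Y S.U) {p : Pt} (hp : p ∈ S.U) {n : E4}
    (hn : isNormalV S.ψ p n) :
    mink n (fderiv ℝ (vecF S.ψ X) p (Y p)) = mink n (fderiv ℝ (vecF S.ψ Y) p (X p)) := by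
  rw [S.fderiv_vecF hX hp, S.fderiv_vecF hY hp, mink_add_right, mink_add_right, hn, hn,
    fderiv_fderiv_symm S.hUopen S.hψ hp]

theorem isNormalV_Zperp {p : Pt} (hp : p ∈ S.U) : isNormalV S.ψ p (S.Zperp p) :=
  S.hZTtangentpart p hp

theorem mink_ZT_ZT {p : Pt} (hp : p ∈ S.U) :
    mink (fderiv ℝ S.ψ p (S.ZT p)) (fderiv ℝ S.ψ p (S.ZT p)) = 1 := by
  have h1 := S.hZperpNull p hp
  have h2 := S.hZTtangentpart p hp (S.ZT p)
  have h3 := S.hZunit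
  rw [mink_sub_left] at h2
  rw [mink_sub_left, mink_sub_right, mink_sub_right, mink_comm (fderiv ℝ S.ψ p (S.ZT p)) S.Z] at h1
  linarith

theorem fderiv_Zperp (p v : Pt) :
    fderiv ℝ S.Zperp p v = -fderiv ℝ (vecF S.ψ S.ZT) p v := by
  have : S.Zperp = fun q => S.Z - vecF S.ψ S.ZT q := rfl
  rw [this, fderiv_const_sub]
  rfl

/-- The tangent and normal parts of `∇̄_X Z^⊤`. -/
theorem fderiv_vecF_ZT (X : Pt → Pt) {p : Pt} (hp : p ∈ S.U) :
    fderiv ℝ (vecF S.ψ S.ZT) p (X p) =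
      fderiv ℝ S.ψ p (S.conn X S.ZT p) + S.beta p (X p) • S.Zperp p := by
  rw [Zperp, ← S.hbeta X p hp]
  exact (add_sub_cancel _ _).symm

theorem beta_eq {p : Pt} (hp : p ∈ S.U) (v : Pt) :
    S.beta p v = mink (S.Wp p) (fderiv ℝ (vecF S.ψ S.ZT) p v) := by
  have h := S.fderiv_vecF_ZT (fun _ => v) hp
  rw [h, mink_add_right, S.hWpNormal p hp, mink_smul_right, mink_comm]
  have := S.hWpPair p hp
  simp only [Zperp, this]
  ring

/-- `⟨∇̄_v Z^⊤, W⟩ = ⟨∇̄_v W, Z^⊥⟩`. -/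
theorem mink_fderiv_ZT_Wc {p : Pt} (hp : p ∈ S.U) (v : Pt) :
    mink (fderiv ℝ (vecF S.ψ S.ZT) p v) (fderiv ℝ S.ψ p (S.Wc p)) =
      mink (S.Zperp p) (fderiv ℝ (vecF S.ψ S.Wc) p v) := by
  have hd : DifferentiableAt ℝ S.Zperp p :=
    (S.differentiableAt_vecF S.hZTsmooth hp).const_sub S.Z
  have := mink_fderiv_add_eq_zero hd (S.differentiableAt_vecF S.hWsmooth hp) (c := 0)
    (Filter.eventually_of_mem (S.hUopen.mem_nhds hp)
      fun q hq => S.isNormalV_Zperp hq (S.Wc q)) v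
  rw [fderiv_Zperp, mink_neg_left] at this
  simp only [vecF] at this ⊢
  linarith

theorem mink_Zperp_Zperp {p : Pt} (hp : p ∈ S.U) : mink (S.Zperp p) (S.Zperp p) = 0 :=
  S.hZperpNull p hp

theorem mink_Zperp_fderiv_ZT {p : Pt} (hp : p ∈ S.U) (v : Pt) :
    mink (S.Zperp p) (fderiv ℝ (vecF S.ψ S.ZT) p v) = 0 := by
  rw [S.fderiv_vecF_ZT (fun _ => v) hp, mink_add_right, S.isNormalV_Zperp hp, mink_smul_right,
    S.mink_Zperp_Zperp hp]
  ring

theorem mink_fderiv_ZT_ZT_Wc {p : Pt} (hp : p ∈ S.U) :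
    mink (S.Zperp p) (fderiv ℝ (vecF S.ψ S.Wc) p (S.ZT p)) = 0 := by
  rw [S.mink_fderiv_vecF_symm S.hWsmooth S.hZTsmooth hp (S.isNormalV_Zperp hp),
    S.mink_Zperp_fderiv_ZT hp]

theorem afun_eq {p : Pt} (hp : p ∈ S.U) :
    S.afun p = mink (S.Zperp p) (fderiv ℝ (vecF S.ψ S.Wc) p (S.Wc p)) := by
  rw [afun, mink_comm]
  simp only [B, sff, Dflat]
  rw [mink_sub_right]
  simp only [vecF]
  rw [S.isNormalV_Zperp hp]
  ring

/-- Expansion of a tangent vector in the frame `(Z^⊤, W)`. -/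
theorem eq_frame {p : Pt} (hp : p ∈ S.U) (v : Pt) :
    v = mink (fderiv ℝ S.ψ p v) (fderiv ℝ S.ψ p (S.ZT p)) • S.ZT p +
      mink (fderiv ℝ S.ψ p v) (fderiv ℝ S.ψ p (S.Wc p)) • S.Wc p := by
  have hD := (S.hWorient p hp).ne'
  obtain ⟨x, y, hxy⟩ : ∃ x y : ℝ, v = x • S.ZT p + y • S.Wc p := by
    refine ⟨(v.1 * (S.Wc p).2 - v.2 * (S.Wc p).1) /
        ((S.ZT p).1 * (S.Wc p).2 - (S.ZT p).2 * (S.Wc p).1),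
      ((S.ZT p).1 * v.2 - (S.ZT p).2 * v.1) /
        ((S.ZT p).1 * (S.Wc p).2 - (S.ZT p).2 * (S.Wc p).1), ?_⟩
    ext
    · simp only [Prod.fst_add, Prod.smul_fst, smul_eq_mul]
      rw [div_mul_eq_mul_div, div_mul_eq_mul_div, ← add_div, eq_div_iff hD]
      ring
    · simp only [Prod.snd_add, Prod.smul_snd, smul_eq_mul]
      rw [div_mul_eq_mul_div, div_mul_eq_mul_div, ← add_div, eq_div_iff hD]
      ring
  have h1 := S.mink_ZT_ZT hp
  have h2 := S.hWunit p hp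
  have h3 := S.hWorth p hp
  have h4 := h3
  rw [mink_comm] at h4
  have hx : mink (fderiv ℝ S.ψ p v) (fderiv ℝ S.ψ p (S.ZT p)) = x := by
    rw [hxy, map_add, map_smul, map_smul, mink_add_left, mink_smul_left, mink_smul_left, h1, h4]
    ring
  have hy : mink (fderiv ℝ S.ψ p v) (fderiv ℝ S.ψ p (S.Wc p)) = y := by
    rw [hxy, map_add, map_smul, map_smul, mink_add_left, mink_smul_left, mink_smul_left, h2, h3]
    ring
  rw [hx, hy, ← hxy]

theorem beta_frame {p : Pt} (hp : p ∈ S.U) (v : Pt) :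
    S.beta p v =
      mink (fderiv ℝ S.ψ p v) (fderiv ℝ S.ψ p (S.ZT p)) * S.beta p (S.ZT p) +
      mink (fderiv ℝ S.ψ p v) (fderiv ℝ S.ψ p (S.Wc p)) * S.beta p (S.Wc p) := by
  conv_lhs => rw [S.beta_eq hp, S.eq_frame hp v]
  rw [map_add, map_smul, map_smul, mink_add_right, mink_smul_right, mink_smul_right,
    ← S.beta_eq hp, ← S.beta_eq hp]

/-- `∇_X Z^⊤ = ⟨∇̄_X W, Z^⊥⟩ W`. -/
theorem conn_ZT (X : Pt → Pt) {p : Pt} (hp : p ∈ S.U) :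
    S.conn X S.ZT p =
      mink (S.Zperp p) (fderiv ℝ (vecF S.ψ S.Wc) p (X p)) • S.Wc p := by
  have hD := S.fderiv_vecF_ZT X hp
  have hT : mink (fderiv ℝ S.ψ p (S.conn X S.ZT p)) (fderiv ℝ S.ψ p (S.ZT p)) = 0 := by
    have h := mink_fderiv_add_eq_zero (S.differentiableAt_vecF S.hZTsmooth hp)
      (S.differentiableAt_vecF S.hZTsmooth hp) (c := 1)
      (Filter.eventually_of_mem (S.hUopen.mem_nhds hp) fun q hq => S.mink_ZT_ZT hq) (X p)
    rw [mink_comm (vecF S.ψ S.ZT p), hD, mink_add_left, mink_smul_left] at h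
    simp only [vecF] at h
    rw [S.isNormalV_Zperp hp] at h
    linarith
  have hW := S.mink_fderiv_ZT_Wc hp (X p)
  rw [hD, mink_add_left, mink_smul_left, S.isNormalV_Zperp hp, mul_zero, add_zero] at hW
  rw [S.eq_frame hp (S.conn X S.ZT p), hT, hW, zero_smul, zero_add]

/-- The normal derivative of `Z^⊥` is `∇⊥_X Z^⊥ = -β(X) Z^⊥`. -/
theorem nconn_Zperp (X : Pt → Pt) {p : Pt} (hp : p ∈ S.U) :
    S.nconn X S.Zperp p = -(S.beta p (X p) • S.Zperp p) := by
  have hd : DifferentiableAt ℝ S.Zperp p :=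
    (S.differentiableAt_vecF S.hZTsmooth hp).const_sub S.Z
  obtain ⟨hn, u, hu⟩ := S.hnconn X S.Zperp p hp (fun q hq => S.isNormalV_Zperp hq) hd
  simp only [Dflat] at hu
  rw [fderiv_Zperp, S.fderiv_vecF_ZT X hp] at hu
  have key : fderiv ℝ S.ψ p (u + S.conn X S.ZT p) =
      -(S.beta p (X p) • S.Zperp p) - S.nconn X S.Zperp p := by
    rw [map_add, hu]; abel
  have hz : u + S.conn X S.ZT p = 0 := by
    by_contra hne
    have hpos := S.hspacelike p hp _ hne
    have : mink (fderiv ℝ S.ψ p (u + S.conn X S.ZT p))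
        (fderiv ℝ S.ψ p (u + S.conn X S.ZT p)) = 0 := by
      nth_rw 1 [key]
      rw [mink_sub_left, mink_neg_left, mink_smul_left, S.isNormalV_Zperp hp, hn]
      ring
    linarith
  rw [hz, map_zero] at key
  exact (sub_eq_zero.1 key.symm).symm

theorem mink_vecF_conn {Y : Pt → Pt} (X : Pt → Pt) (hY : ContDiffOn ℝ (⊤ : ℕ∞) Y S.U)
    {p : Pt} (hp : p ∈ S.U) (v : Pt) :
    mink (fderiv ℝ S.ψ p (S.conn X Y p)) (fderiv ℝ S.ψ p v) =
      mink (Dflat X (vecF S.ψ Y) p) (fderiv ℝ S.ψ p v) := by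
  have := S.hconn X Y p hp (S.differentiableAt_vecF hY hp) v
  rw [sff, mink_sub_left] at this
  simp only [vecF] at this ⊢
  linarith

/-- Derivative of the tangential part `∇_X Z^⊤`, split by `∇̄_X Z^⊤ = ∇_X Z^⊤ + β(X) Z^⊥`. -/
theorem Dflat_vecF_conn_ZT {X : Pt → Pt} (hX : ContDiffOn ℝ (⊤ : ℕ∞) X S.U) (Y : Pt → Pt)
    {p : Pt} (hp : p ∈ S.U) :
    Dflat Y (vecF S.ψ (S.conn X S.ZT)) p =
      Dflat Y (Dflat X (vecF S.ψ S.ZT)) p -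
        Dflat Y (fun q => S.beta q (X q) • S.Zperp q) p ∧
    DifferentiableAt ℝ (fun q => S.beta q (X q) • S.Zperp q) p := by
  have hE := S.differentiableAt_vecF (S.hconnSmooth X S.ZT hX S.hZTsmooth) hp
  have hD : DifferentiableAt ℝ (Dflat X (vecF S.ψ S.ZT)) p :=
    (ContDiffOn.fderiv_apply_field S.hUopen (S.contDiffOn_vecF S.hZTsmooth)
      hX).differentiableAt_of_isOpen S.hUopen hp
  have hev : (fun q => S.beta q (X q) • S.Zperp q) =ᶠ[nhds p]
      (fun q => Dflat X (vecF S.ψ S.ZT) q - vecF S.ψ (S.conn X S.ZT) q) :=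
    Filter.eventually_of_mem (S.hUopen.mem_nhds hp) fun q hq => (S.hbeta X q hq).symm
  refine ⟨?_, (hD.sub hE).congr_of_eventuallyEq hev⟩
  have hfd : fderiv ℝ (fun q => S.beta q (X q) • S.Zperp q) p =
      fderiv ℝ (Dflat X (vecF S.ψ S.ZT)) p - fderiv ℝ (vecF S.ψ (S.conn X S.ZT)) p := by
    rw [hev.fderiv_eq]
    exact fderiv_sub hD hE
  have := congrArg (fun L : Pt →L[ℝ] E4 => L (Y p)) hfd
  simp only [sub_apply] at this
  simp only [Dflat] at this ⊢
  rw [this]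
  abel

theorem mink_Dflat_beta_Zperp_Wc {X : Pt → Pt} (hX : ContDiffOn ℝ (⊤ : ℕ∞) X S.U)
    (Y : Pt → Pt) {p : Pt} (hp : p ∈ S.U) :
    mink (Dflat Y (fun q => S.beta q (X q) • S.Zperp q) p) (fderiv ℝ S.ψ p (S.Wc p)) =
      -(S.beta p (X p) * mink (S.Zperp p) (fderiv ℝ (vecF S.ψ S.Wc) p (Y p))) := by
  have h := mink_fderiv_add_eq_zero (S.Dflat_vecF_conn_ZT hX Y hp).2
    (S.differentiableAt_vecF S.hWsmooth hp) (c := 0)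
    (Filter.eventually_of_mem (S.hUopen.mem_nhds hp) fun q hq => by
      rw [mink_smul_left, vecF, S.isNormalV_Zperp hq, mul_zero]) (Y p)
  rw [mink_smul_left] at h
  simp only [vecF, Dflat] at h ⊢
  linarith

/-- The Gauss equation `K = a β(Z^⊤)`. -/
theorem Kfun_eq {p : Pt} (hp : p ∈ S.U) : S.Kfun p = S.afun p * S.beta p (S.ZT p) := by
  have hflat := congrArg (fun x => mink x (fderiv ℝ S.ψ p (S.Wc p)))
    (Dflat_Dflat_sub S.hUopen (S.contDiffOn_vecF S.hZTsmooth) S.hZTsmooth S.hWsmooth hp)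
  simp only [mink_add_left, mink_sub_left, mink_comm 0, mink_zero_right] at hflat
  rw [Kfun, curvR, map_add, map_sub, mink_add_left, mink_sub_left,
    S.mink_vecF_conn _ (S.hconnSmooth _ _ S.hZTsmooth S.hZTsmooth) hp,
    S.mink_vecF_conn _ (S.hconnSmooth _ _ S.hWsmooth S.hZTsmooth) hp,
    S.mink_vecF_conn _ S.hZTsmooth hp,
    (S.Dflat_vecF_conn_ZT S.hZTsmooth S.Wc hp).1, (S.Dflat_vecF_conn_ZT S.hWsmooth S.ZT hp).1,
    mink_sub_left, mink_sub_left, S.mink_Dflat_beta_Zperp_Wc S.hZTsmooth S.Wc hp,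
    S.mink_Dflat_beta_Zperp_Wc S.hWsmooth S.ZT hp, S.mink_fderiv_ZT_ZT_Wc hp, ← S.afun_eq hp]
  linarith

theorem mink_nconn_nconn_Zperp {X : Pt → Pt} (hX : ContDiffOn ℝ (⊤ : ℕ∞) X S.U)
    (Y : Pt → Pt) {p : Pt} (hp : p ∈ S.U) :
    mink (S.nconn Y (S.nconn X S.Zperp) p) (S.Wp p) =
      -mink (Dflat Y (fun q => S.beta q (X q) • S.Zperp q) p) (S.Wp p) := by
  have hev : S.nconn X S.Zperp =ᶠ[nhds p] (fun q => -(S.beta q (X q) • S.Zperp q)) :=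
    Filter.eventually_of_mem (S.hUopen.mem_nhds hp) fun q hq => S.nconn_Zperp X hq
  have hd := (S.Dflat_vecF_conn_ZT hX Y hp).2
  have hnd : DifferentiableAt ℝ (S.nconn X S.Zperp) p := hd.neg.congr_of_eventuallyEq hev
  obtain ⟨-, u, hu⟩ := S.hnconn Y (S.nconn X S.Zperp) p hp
    (fun q hq v => by
      rw [S.nconn_Zperp X hq, mink_neg_left, mink_smul_left, S.isNormalV_Zperp hq]; ring) hnd
  have h := S.hWpNormal p hp u
  rw [hu, mink_comm, mink_sub_left, sub_eq_zero] at h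
  rw [← h, ← mink_neg_left, Dflat, hev.fderiv_eq, fderiv_fun_neg]
  rfl

theorem mink_Dflat_vecF_conn_ZT_Wp {X Y : Pt → Pt} (hX : ContDiffOn ℝ (⊤ : ℕ∞) X S.U)
    (hY : ContDiffOn ℝ (⊤ : ℕ∞) Y S.U) {p : Pt} (hp : p ∈ S.U) :
    mink (Dflat Y (vecF S.ψ (S.conn X S.ZT)) p) (S.Wp p) =
      mink (S.Zperp p) (fderiv ℝ (vecF S.ψ S.Wc) p (X p)) *
        mink (S.Wp p) (fderiv ℝ (vecF S.ψ Y) p (S.Wc p)) := by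
  rw [Dflat, mink_comm, S.mink_fderiv_vecF_symm (S.hconnSmooth X S.ZT hX S.hZTsmooth) hY hp
    (S.hWpNormal p hp), S.conn_ZT X hp, map_smul, mink_smul_right]

/-- The Ricci equation `K_N = -a β(W)`. -/
theorem KNfun_eq {p : Pt} (hp : p ∈ S.U) : S.KNfun p = -(S.afun p * S.beta p (S.Wc p)) := by
  have hflat := congrArg (fun x => mink x (S.Wp p))
    (Dflat_Dflat_sub S.hUopen (S.contDiffOn_vecF S.hZTsmooth) S.hZTsmooth S.hWsmooth hp)
  simp only [mink_add_left, mink_sub_left, mink_comm 0, mink_zero_right] at hflat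
  have h1 := S.mink_Dflat_vecF_conn_ZT_Wp S.hZTsmooth S.hWsmooth hp
  have h2 := S.mink_Dflat_vecF_conn_ZT_Wp S.hWsmooth S.hZTsmooth hp
  rw [S.mink_fderiv_ZT_ZT_Wc hp, (S.Dflat_vecF_conn_ZT S.hZTsmooth S.Wc hp).1,
    mink_sub_left] at h1
  rw [← S.afun_eq hp, ← S.beta_eq hp, (S.Dflat_vecF_conn_ZT S.hWsmooth S.ZT hp).1,
    mink_sub_left] at h2
  have h3 : mink (Dflat (lieB S.ZT S.Wc) (vecF S.ψ S.ZT) p) (S.Wp p) =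
      S.beta p (lieB S.ZT S.Wc p) := by
    rw [S.beta_eq hp, mink_comm]; rfl
  have hpair : mink (S.Zperp p) (S.Wp p) = 1 := S.hWpPair p hp
  rw [KNfun, curvRperp, mink_add_left, mink_sub_left,
    S.mink_nconn_nconn_Zperp S.hZTsmooth S.Wc hp, S.mink_nconn_nconn_Zperp S.hWsmooth S.ZT hp,
    S.nconn_Zperp _ hp, mink_neg_left, mink_smul_left, hpair]
  linarith

end CNND

/-- If `a ≠ 0`, the 1-form `β` is given by
`β(X) = ⟨X, (K/a) Z^⊤ + (−K_N/a) W⟩` for every tangent vector `X`.  In particular, if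
`a ≠ 0` and `K = K_N = 0` at every point, then `Z^⊥` is a parallel normal vector field. -/
theorem cnnd_beta_formula_of_a_ne_zero (S : CNND) (ha : ∀ p ∈ S.U, S.afun p ≠ 0) :
    (∀ p ∈ S.U, ∀ v : Pt,
      S.beta p v =
        mink (fderiv ℝ S.ψ p v)
          (fderiv ℝ S.ψ p ((S.Kfun p / S.afun p) • S.ZT p + (-S.KNfun p / S.afun p) • S.Wc p))) ∧
    ((∀ p ∈ S.U, S.Kfun p = 0 ∧ S.KNfun p = 0) →
      ∀ X : Pt → Pt, ∀ p ∈ S.U, S.nconn X S.Zperp p = 0) := by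
  have hβ : ∀ p ∈ S.U, ∀ v : Pt,
      S.beta p v =
        mink (fderiv ℝ S.ψ p v)
          (fderiv ℝ S.ψ p
            ((S.Kfun p / S.afun p) • S.ZT p + (-S.KNfun p / S.afun p) • S.Wc p)) := by
    intro p hp v
    have hK : S.Kfun p / S.afun p = S.beta p (S.ZT p) := by
      rw [S.Kfun_eq hp, mul_div_cancel_left₀ _ (ha p hp)]
    have hKN : -S.KNfun p / S.afun p = S.beta p (S.Wc p) := by
      rw [S.KNfun_eq hp, neg_neg, mul_div_cancel_left₀ _ (ha p hp)]
    rw [hK, hKN, S.beta_frame hp v, map_add, map_smul, map_smul, mink_add_right,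
      mink_smul_right, mink_smul_right]
    ring
  refine ⟨hβ, fun h X p hp => ?_⟩
  rw [S.nconn_Zperp X hp, hβ p hp, (h p hp).1, (h p hp).2]
  simp [mink_zero_right]

end
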